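/- arXiv:2204.01610 — 3 statements merged into one kernel-verified Lean document; each statement's English description precedes it below -/
import Mathlib

section
/- Let k = 3 and let (M_n) be a sequence of integers with 1 ≤ M_n ≤ 3n−1 and M_n/(3n) → c for some c ∈ (0,1). Then lim_{n→∞} P_{n,3}(S(n,3;M_n)) = −(3/2)(1−c)c(1+3c) − (3c+3c²+c³)·log c + ((3/2)c+(3/2)c²−c³)·log(c²−3c+3) + 3√3·(−c+c²)·arctan((3−2c)/√3) + (√3·π/2)·(c−c²). -/
open Finset Filter

open scoped Classical

/-- The sample space `Ω_{n,k}`: sequences of length `k*n` with values in `Fin n`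
(the value `v : Fin n` encodes the rank `v+1`), in which each value appears exactly `k`
times; these are the permutations of the multiset `{1^k, 2^k, …, n^k}`. -/
def multisetPerms (n k : ℕ) : Finset (Fin (k*n) → Fin n) :=
  Finset.univ.filter (fun w => ∀ v : Fin n, (Finset.univ.filter (fun i => w i = v)).card = k)

/-- The maximum (as a `0`-based value) among the first `M` entries of `w`. -/
def firstMax (n k M : ℕ) (w : Fin (k*n) → Fin n) : ℕ :=
  (Finset.univ.filter (fun t : Fin (k*n) => (t : ℕ) < M)).sup (fun t => (w t : ℕ))

/-- The strategy `S(n,k;M)` succeeds on `w`: there is an index `i` beyond the first `M`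
entries whose value is `≥` the maximum of the first `M` entries, and the first such index
carries an item of the highest rank `n`. -/
def succeedsS (n k M : ℕ) (w : Fin (k*n) → Fin n) : Prop :=
  ∃ i : Fin (k*n), M ≤ (i : ℕ) ∧ firstMax n k M w ≤ (w i : ℕ) ∧
    (∀ i' : Fin (k*n), M ≤ (i' : ℕ) → firstMax n k M w ≤ (w i' : ℕ) → i ≤ i') ∧
    (w i : ℕ) + 1 = n

/-- The strategy `S⁺(n,k;M)` succeeds on `w`: there is an index `i` beyond the first `M`
entries whose value is strictly greater than the maximum of the first `M` entries, and the
first such index carries an item of the highest rank `n`. -/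
def succeedsSplus (n k M : ℕ) (w : Fin (k*n) → Fin n) : Prop :=
  ∃ i : Fin (k*n), M ≤ (i : ℕ) ∧ firstMax n k M w < (w i : ℕ) ∧
    (∀ i' : Fin (k*n), M ≤ (i' : ℕ) → firstMax n k M w < (w i' : ℕ) → i ≤ i') ∧
    (w i : ℕ) + 1 = n

/-- `P_{n,k}(S(n,k;M))`: the probability of success of strategy `S(n,k;M)` under the
uniform measure on `Ω_{n,k}`. -/
noncomputable def probS (n k M : ℕ) : ℝ :=
  (((multisetPerms n k).filter (succeedsS n k M)).card : ℝ) / ((multisetPerms n k).card : ℝ)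

/-- `P_{n,k}(S⁺(n,k;M))`: the probability of success of strategy `S⁺(n,k;M)` under the
uniform measure on `Ω_{n,k}`. -/
noncomputable def probSplus (n k M : ℕ) : ℝ :=
  (((multisetPerms n k).filter (succeedsSplus n k M)).card : ℝ) / ((multisetPerms n k).card : ℝ)

/-- The event `A^{(n)}_{M,j,l}`: among the first `M` entries, the rank `j` appears exactly
`l` times and no rank greater than `j` appears. -/
def eventA (n k M j l : ℕ) (w : Fin (k*n) → Fin n) : Prop :=
  ((Finset.univ.filter (fun i : Fin (k*n) => (i : ℕ) < M ∧ (w i : ℕ) + 1 = j)).card = l) ∧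
  ∀ i : Fin (k*n), (i : ℕ) < M → (w i : ℕ) + 1 ≤ j

section
theorem card_mul_sum_eq_of_swap_invariant {α : Type*} [DecidableEq α] (E : Finset (Equiv.Perm α)) (S : Finset α)
    (f : α → Equiv.Perm α → ℝ) (C : ℝ)
    (hE : ∀ x ∈ S, ∀ y ∈ S, ∀ g ∈ E, g * Equiv.swap x y ∈ E)
    (hf : ∀ x ∈ S, ∀ y ∈ S, ∀ g ∈ E, f x (g * Equiv.swap x y) = f y g)
    (hC : ∀ g ∈ E, ∑ x ∈ S, f x g = C) {x : α} (hx : x ∈ S) :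
    (#S : ℝ) * ∑ g ∈ E, f x g = C * #E := by
  have h : ∀ y ∈ S, ∑ g ∈ E, f y g = ∑ g ∈ E, f x g := by
    intro y hy
    refine Finset.sum_nbij' (fun g => g * Equiv.swap x y) (fun g => g * Equiv.swap x y)
      (fun g hg => hE x hx y hy g hg) (fun g hg => hE x hx y hy g hg) ?_ ?_ ?_
    · intro g _; simp [mul_assoc]
    · intro g _; simp [mul_assoc]
    · intro g hg; exact (hf x hx y hy g hg).symm
  calc (#S : ℝ) * ∑ g ∈ E, f x g = ∑ y ∈ S, ∑ g ∈ E, f y g := by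
        rw [Finset.sum_congr rfl h]; simp
    _ = ∑ g ∈ E, C := by rw [Finset.sum_comm]; exact Finset.sum_congr rfl hC
    _ = C * #E := by simp [mul_comm]

variable {α : Type*} [Fintype α]

/-- The permutations sending `L` into `F` and `T` into the complement of `F`. -/
noncomputable def placed (F L T : Finset α) : Finset (Equiv.Perm α) :=
  univ.filter fun g => (∀ x ∈ L, g x ∈ F) ∧ ∀ x ∈ T, g x ∉ F

theorem mem_placed {F L T : Finset α} {g : Equiv.Perm α} :
    g ∈ placed F L T ↔ (∀ x ∈ L, g x ∈ F) ∧ ∀ x ∈ T, g x ∉ F := by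
  simp [placed]

theorem placed_compl (F L T : Finset α) : placed Fᶜ T L = placed F L T := by
  ext g; simp [mem_placed, and_comm]

theorem card_placed_insert_left (F L T : Finset α) (hLT : Disjoint L T) {x : α}
    (hxL : x ∉ L) (hxT : x ∉ T) :
    ((Fintype.card α : ℝ) - #L - #T) * #(placed F (insert x L) T)
      = ((#F : ℝ) - #L) * #(placed F L T) := by
  have key := card_mul_sum_eq_of_swap_invariant (placed F L T) (L ∪ T)ᶜ
    (fun x g => if g x ∈ F then 1 else 0) ((#F : ℝ) - #L) ?_ ?_ ?_ (x := x) (by simp [hxL, hxT])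
  · have h1 : (#(L ∪ T)ᶜ : ℝ) = (Fintype.card α : ℝ) - #L - #T := by
      rw [card_compl, Nat.cast_sub (card_le_univ _), card_union_of_disjoint hLT]
      push_cast; ring
    rw [← key, h1]
    congr 1
    rw [Finset.sum_boole]
    congr 2
    ext g
    simp only [mem_placed, mem_filter, mem_insert, forall_eq_or_imp]
    tauto
  · intro y hy z hz g hg
    simp only [mem_compl, mem_union, not_or] at hy hz
    rw [mem_placed] at hg ⊢
    constructor
    · intro u hu
      rw [Equiv.Perm.mul_apply, Equiv.swap_apply_of_ne_of_ne]
      · exact hg.1 u hu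
      · rintro rfl; exact hy.1 hu
      · rintro rfl; exact hz.1 hu
    · intro u hu
      rw [Equiv.Perm.mul_apply, Equiv.swap_apply_of_ne_of_ne]
      · exact hg.2 u hu
      · rintro rfl; exact hy.2 hu
      · rintro rfl; exact hz.2 hu
  · intro y _ z _ g _
    simp
  · intro g hg
    rw [mem_placed] at hg
    rw [Finset.sum_boole]
    have h2 : #(univ.filter fun y => g y ∈ F) = #F := by
      rw [← Finset.card_map g.symm.toEmbedding (s := F)]
      congr 1; ext y; simp
    have h3 : (univ.filter fun y => g y ∈ F) = L ∪ (L ∪ T)ᶜ.filter fun y => g y ∈ F := by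
      ext y
      have := hg.1 y
      have := hg.2 y
      simp only [mem_filter, mem_univ, true_and, mem_union, mem_compl]
      tauto
    rw [← h2, h3, card_union_of_disjoint]
    · push_cast; ring
    · rw [Finset.disjoint_left]
      intro y hy
      simp [hy]

theorem card_placed_insert_right (F L T : Finset α) (hLT : Disjoint L T) {x : α}
    (hxL : x ∉ L) (hxT : x ∉ T) :
    ((Fintype.card α : ℝ) - #L - #T) * #(placed F L (insert x T))
      = ((Fintype.card α : ℝ) - #F - #T) * #(placed F L T) := by
  have h := card_placed_insert_left Fᶜ T L hLT.symm hxT hxL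
  rw [placed_compl, placed_compl, card_compl, Nat.cast_sub (card_le_univ _)] at h
  rw [← h]; ring

/-- The probability that, for a uniform permutation of `N` points, `l` given points land among
the first `M` positions and `t` other given points land among the last `N - M` positions. -/
noncomputable def placedProb (N M l t : ℕ) : ℝ :=
  (∏ i ∈ range l, ((M : ℝ) - i) / (N - i)) * ∏ i ∈ range t, ((N : ℝ) - M - i) / (N - l - i)

theorem card_placed_empty_right (F L : Finset α) :
    (#(placed F L ∅) : ℝ)
      = (Fintype.card α).factorial * placedProb (Fintype.card α) #F #L 0 := by
  induction L using Finset.induction_on with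
  | empty => simp [placed, placedProb, Fintype.card_perm]
  | insert x L hx ih =>
    have h := card_placed_insert_left F L ∅ (disjoint_empty_right _) hx (notMem_empty _)
    have hlt : (#L : ℝ) < Fintype.card α := by
      have : #(insert x L) ≤ Fintype.card α := card_le_univ _
      rw [card_insert_of_notMem hx] at this
      exact_mod_cast this
    rw [ih] at h
    have hne : (Fintype.card α : ℝ) - #L ≠ 0 := by linarith
    simp only [placedProb, card_insert_of_notMem hx, prod_range_succ, range_zero, prod_empty,
      card_empty, Nat.cast_zero, sub_zero, mul_one] at h ⊢
    rw [mul_comm, ← eq_div_iff hne] at h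
    rw [h]; ring

theorem card_placed (F L T : Finset α) (hLT : Disjoint L T) :
    (#(placed F L T) : ℝ)
      = (Fintype.card α).factorial * placedProb (Fintype.card α) #F #L #T := by
  induction T using Finset.induction_on with
  | empty => simpa using card_placed_empty_right F L
  | insert x T hx ih =>
    rw [disjoint_insert_right] at hLT
    have h := card_placed_insert_right F L T hLT.2 hLT.1 hx
    have hlt : (#L : ℝ) + #T < Fintype.card α := by
      have : #(insert x (L ∪ T)) ≤ Fintype.card α := card_le_univ _
      rw [card_insert_of_notMem (by simp [hLT.1, hx]), card_union_of_disjoint hLT.2] at this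
      exact_mod_cast this
    rw [ih hLT.2] at h
    have hne : (Fintype.card α : ℝ) - #L - #T ≠ 0 := by linarith
    simp only [placedProb, card_insert_of_notMem hx, prod_range_succ] at h ⊢
    rw [mul_comm, ← eq_div_iff hne] at h
    rw [h]; ring

theorem card_placed_le (F L T : Finset α) :
    (#(placed F L T) : ℝ)
      ≤ (Fintype.card α).factorial * (1 - (#F : ℝ) / Fintype.card α) ^ #T := by
  have h0 : (#(placed F L T) : ℝ) ≤ #(placed F ∅ T) := by
    refine Nat.cast_le.2 (card_le_card fun g hg => ?_)
    rw [mem_placed] at hg ⊢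
    exact ⟨by simp, hg.2⟩
  refine h0.trans ?_
  clear h0
  induction T using Finset.induction_on with
  | empty => simp [placed, Fintype.card_perm]
  | insert x T hx ih =>
    have h := card_placed_insert_right F ∅ T (disjoint_empty_left _) (notMem_empty _) hx
    have hlt : (#T : ℝ) < Fintype.card α := by
      have : #(insert x T) ≤ Fintype.card α := card_le_univ _
      rw [card_insert_of_notMem hx] at this
      exact_mod_cast this
    have hT : (0 : ℝ) ≤ #T := by positivity
    have hF : (0 : ℝ) ≤ #F := by positivity
    have hN : (0 : ℝ) < Fintype.card α := by linarith
    have hFN : (#F : ℝ) / Fintype.card α ≤ 1 := by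
      rw [div_le_one hN]; exact_mod_cast card_le_univ F
    have hstep : (#(placed F ∅ (insert x T)) : ℝ)
        ≤ #(placed F ∅ T) * (1 - (#F : ℝ) / Fintype.card α) := by
      have hp : (0 : ℝ) ≤ #(placed F ∅ T) := by positivity
      have hle : ((Fintype.card α : ℝ) - #F - #T)
          ≤ (1 - (#F : ℝ) / Fintype.card α) * (Fintype.card α - #T) := by
        have : (#F : ℝ) / Fintype.card α * Fintype.card α = #F := by field_simp
        have h2 : 0 ≤ (#F : ℝ) / Fintype.card α * #T := by positivity
        nlinarith
      have h3 := mul_le_mul_of_nonneg_right hle hp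
      rw [← h] at h3
      simp only [card_empty, Nat.cast_zero, sub_zero] at h3
      have hpos : (0 : ℝ) < Fintype.card α - #T := by linarith
      refine le_of_mul_le_mul_left (h3.trans (le_of_eq (by ring))) hpos
    rw [card_insert_of_notMem hx, pow_succ, ← mul_assoc]
    exact hstep.trans (mul_le_mul_of_nonneg_right ih (by linarith))

theorem card_mul_card_first [LinearOrder α] (F L T : Finset α) (hLT : Disjoint L T) {t : α}
    (ht : t ∈ T) :
    (#T : ℝ) * #{g ∈ placed F L T | ∀ s ∈ T, g t ≤ g s} = #(placed F L T) := by
  have key := card_mul_sum_eq_of_swap_invariant (placed F L T) T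
    (fun x g => if ∀ s ∈ T, g x ≤ g s then 1 else 0) 1 ?_ ?_ ?_ ht
  · rw [Finset.sum_boole, one_mul] at key
    exact key
  · intro y hy z hz g hg
    rw [mem_placed] at hg ⊢
    constructor
    · intro u hu
      rw [Equiv.Perm.mul_apply, Equiv.swap_apply_of_ne_of_ne]
      · exact hg.1 u hu
      · rintro rfl; exact disjoint_left.1 hLT hu hy
      · rintro rfl; exact disjoint_left.1 hLT hu hz
    · intro u hu
      rw [Equiv.Perm.mul_apply]
      refine hg.2 _ ?_
      rw [Equiv.swap_apply_def]
      split_ifs <;> assumption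
  · intro y hy z hz g _
    simp only [Equiv.Perm.mul_apply, Equiv.swap_apply_left]
    congr 1
    have hsw : ∀ s ∈ T, Equiv.swap y z s ∈ T := by
      intro s hs
      rw [Equiv.swap_apply_def]
      split_ifs <;> assumption
    refine propext ⟨fun h s hs => ?_, fun h s hs => h _ (hsw s hs)⟩
    simpa using h _ (hsw s hs)
  · intro g _
    obtain ⟨m, hm, hmin⟩ := exists_min_image T g ⟨t, ht⟩
    rw [Finset.sum_eq_single_of_mem m hm, if_pos hmin]
    intro y hy hne
    rw [if_neg]
    intro h
    exact hne (g.injective (le_antisymm (h m hm) (hmin y hy)))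

theorem card_filter_exists_first [LinearOrder α] (F L T : Finset α) (hLT : Disjoint L T)
    (q : α → Prop) [DecidablePred q] :
    (#{g ∈ placed F L T | ∃ t ∈ T, q t ∧ ∀ s ∈ T, g t ≤ g s} : ℝ)
      = #(placed F L T) * (#{t ∈ T | q t} / #T) := by
  have hU : {g ∈ placed F L T | ∃ t ∈ T, q t ∧ ∀ s ∈ T, g t ≤ g s}
      = {t ∈ T | q t}.biUnion fun t => {g ∈ placed F L T | ∀ s ∈ T, g t ≤ g s} := by
    ext g
    simp only [mem_filter, mem_biUnion]
    tauto
  rw [hU, card_biUnion]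
  · push_cast
    have h : ∀ t ∈ {t ∈ T | q t},
        (#{g ∈ placed F L T | ∀ s ∈ T, g t ≤ g s} : ℝ) = #(placed F L T) / #T := by
      intro t ht
      have htT := (mem_filter.1 ht).1
      rw [eq_div_iff (by exact_mod_cast (card_pos.2 ⟨t, htT⟩).ne'), mul_comm]
      exact card_mul_card_first F L T hLT htT
    rw [Finset.sum_congr rfl h]
    simp only [sum_const, nsmul_eq_mul]
    ring
  · intro t ht t' ht' hne
    rw [Function.onFun, disjoint_left]
    intro g h1 h2
    simp only [coe_filter, Set.mem_ofPred_eq, mem_filter] at h1 h2 ht ht'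
    exact hne (g.injective (le_antisymm (h1.2 _ ht'.1) (h2.2 _ ht.1)))

theorem exists_perm_comp_eq {β : Type*} [DecidableEq β] [Fintype β] (r w : α → β)
    (h : ∀ v, #{i | r i = v} = #{i | w i = v}) :
    ∃ g : Equiv.Perm α, r ∘ g.symm = w := by
  have e : ∀ v, Nonempty ({i // r i = v} ≃ {i // w i = v}) := by
    intro v
    rw [← Fintype.card_eq, Fintype.card_subtype, Fintype.card_subtype]
    exact h v
  replace e := fun v => (e v).some
  refine ⟨(Equiv.sigmaFiberEquiv r).symm.trans
    ((Equiv.sigmaCongrRight fun v => (e v)).trans (Equiv.sigmaFiberEquiv w)), ?_⟩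
  funext i
  simp only [Function.comp_apply, Equiv.symm_trans_apply, Equiv.symm_symm]
  obtain ⟨⟨v, x⟩, rfl⟩ := (Equiv.sigmaFiberEquiv w).surjective i
  simp only [Equiv.symm_apply_apply]
  have := ((e v).symm x).2
  have h2 := x.2
  exact this.trans h2.symm

theorem exists_card_filter_perm_eq_mul [DecidableEq α] {β : Type*} [DecidableEq β] [Fintype β]
    (r : α → β) (k : β → ℕ) (hr : ∀ v, #{i | r i = v} = k v) (Ω : Finset (α → β))
    (hΩ : ∀ w, w ∈ Ω ↔ ∀ v, #{i | w i = v} = k v) :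
    ∃ K : ℕ, K ≠ 0 ∧ ∀ P : (α → β) → Prop,
      #{g : Equiv.Perm α | P (r ∘ g.symm)} = #(Ω.filter P) * K := by
  refine ⟨#{g : Equiv.Perm α | r ∘ g.symm = r}, (card_pos.2 ⟨1, ?_⟩).ne', fun P => ?_⟩
  · simp [Equiv.Perm.one_def]
  have hcard : ∀ g : Equiv.Perm α, ∀ v, #{i | (r ∘ g.symm) i = v} = k v := by
    intro g v
    rw [← hr v, ← Finset.card_map g.toEmbedding (s := {i | r i = v})]
    congr 1; ext y; simp
  rw [Finset.card_eq_sum_card_fiberwise (f := fun g : Equiv.Perm α => r ∘ g.symm)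
    (t := Ω.filter P), Finset.sum_const_nat]
  · intro w hw
    rw [mem_filter, hΩ] at hw
    obtain ⟨h, rfl⟩ := exists_perm_comp_eq r w fun v => (hr v).trans (hw.1 v).symm
    refine card_nbij' (fun g => h⁻¹ * g) (fun g => h * g) ?_ ?_ ?_ ?_
    · intro g hg
      simp only [coe_filter, mem_filter, mem_univ, true_and, Set.mem_ofPred_eq] at hg ⊢
      funext i
      have := congrFun hg.2 (h i)
      simpa [Equiv.Perm.mul_def, Equiv.Perm.inv_def] using this
    · intro g hg
      simp only [coe_filter, mem_filter, mem_univ, true_and, Set.mem_ofPred_eq] at hg ⊢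
      have h1 : r ∘ (h * g).symm = r ∘ h.symm := by
        funext i
        exact congrFun hg (h.symm i)
      exact ⟨by rw [h1]; exact hw.2, h1⟩
    · intro g _; simp
    · intro g _; simp
  · intro g hg
    simp only [coe_filter, mem_univ, true_and, Set.mem_ofPred_eq, hΩ] at hg ⊢
    exact ⟨hcard g, hg⟩
end

/-- The first `M` positions. -/
def front (N M : ℕ) : Finset (Fin N) := {p | (p : ℕ) < M}

theorem card_front {N M : ℕ} (h : M ≤ N) : #(front N M) = M := by
  rw [front, Fin.card_filter_val_lt, min_eq_right h]

/-- The items of rank at least `j` that do not belong to `L`. -/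
def laterItems {N n : ℕ} (r : Fin N → Fin n) (j : Fin n) (L : Finset (Fin N)) : Finset (Fin N) :=
  (univ.filter fun x => j ≤ r x) \ L

section
variable {N n : ℕ} (r : Fin N → Fin n)

theorem eq_of_mem_placed_later {F : Finset (Fin N)} {j : Fin n} {L : Finset (Fin N)}
    (hL : ∀ x ∈ L, r x = j) {g : Equiv.Perm (Fin N)}
    (hg : g ∈ placed F L (laterItems r j L)) : L = univ.filter fun x => j ≤ r x ∧ g x ∈ F := by
  rw [mem_placed] at hg
  ext x
  have h1 := hg.1 x
  have h2 := hg.2 x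
  have h3 := hL x
  simp only [laterItems, Finset.mem_sdiff, mem_filter, mem_univ, true_and] at h2 ⊢
  constructor
  · intro hx
    exact ⟨(h3 hx).ge, h1 hx⟩
  · rintro ⟨ha, hb⟩
    by_contra hc
    exact h2 ⟨ha, hc⟩ hb

theorem le_of_mem_placed_later {F : Finset (Fin N)} {j : Fin n} {L : Finset (Fin N)}
    (hL : ∀ x ∈ L, r x = j) {g : Equiv.Perm (Fin N)}
    (hg : g ∈ placed F L (laterItems r j L)) {x : Fin N} (hx : g x ∈ F) : r x ≤ j := by
  by_contra! hlt
  have h := eq_of_mem_placed_later r hL hg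
  have hxL : x ∈ L := by rw [h]; simp [hx, hlt.le]
  exact hlt.ne' (hL x hxL)

theorem exists_mem_placed_later {F : Finset (Fin N)} (hF : F.Nonempty) (g : Equiv.Perm (Fin N)) :
    ∃ q : (_ : Fin n) × Finset (Fin N), (∀ x ∈ q.2, r x = q.1) ∧ q.2.Nonempty ∧
      g ∈ placed F q.2 (laterItems r q.1 q.2) := by
  obtain ⟨p, hp, hmax⟩ := exists_max_image F (fun p => r (g.symm p)) hF
  refine ⟨⟨r (g.symm p), univ.filter fun x => r x = r (g.symm p) ∧ g x ∈ F⟩, ?_, ⟨g.symm p, by simp [hp]⟩, ?_⟩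
  · intro x; simp +contextual
  · rw [mem_placed]
    refine ⟨by simp +contextual, fun x hx hxF => ?_⟩
    simp only [laterItems, Finset.mem_sdiff, mem_filter, mem_univ, true_and, not_and] at hx
    have := hmax _ hxF
    simp only [Equiv.symm_apply_apply] at this
    exact hx.2 (le_antisymm this hx.1) hxF

theorem card_filter_perm_eq_sum {F : Finset (Fin N)} (hF : F.Nonempty)
    (P : Equiv.Perm (Fin N) → Prop) :
    #{g | P g} = ∑ j : Fin n, ∑ L ∈ (univ.filter fun x => r x = j).powerset.filter Finset.Nonempty,
      #{g ∈ placed F L (laterItems r j L) | P g} := by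
  choose f hf using exists_mem_placed_later r hF
  rw [Finset.sum_sigma', Finset.card_eq_sum_card_fiberwise (f := f)
    (t := univ.sigma fun j => (univ.filter fun x => r x = j).powerset.filter Finset.Nonempty)]
  · refine Finset.sum_congr rfl fun q hq => ?_
    simp only [mem_sigma, mem_univ, true_and, mem_filter, mem_powerset, subset_iff] at hq
    congr 1
    ext g
    simp only [mem_filter, mem_univ, true_and]
    constructor
    · rintro ⟨hg, rfl⟩
      exact ⟨(hf g).2.2, hg⟩
    · rintro ⟨hg, hP⟩
      refine ⟨hP, ?_⟩
      obtain ⟨h1, h2, h3⟩ := hf g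
      have hle : ∀ q q' : (_ : Fin n) × Finset (Fin N), (∀ x ∈ q.2, r x = q.1) → q.2.Nonempty →
          g ∈ placed F q.2 (laterItems r q.1 q.2) → (∀ x ∈ q'.2, r x = q'.1) →
          g ∈ placed F q'.2 (laterItems r q'.1 q'.2) → q.1 ≤ q'.1 := by
        rintro q q' hq ⟨x, hx⟩ hg hq' hg'
        rw [← hq x hx]
        exact le_of_mem_placed_later r hq' hg' ((mem_placed.1 hg).1 x hx)
      have hj : (f g).1 = q.1 :=
        le_antisymm (hle _ _ h1 h2 h3 hq.1 hg) (hle _ _ hq.1 hq.2 hg h1 h3)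
      refine Sigma.ext hj (heq_of_eq ?_)
      rw [eq_of_mem_placed_later r h1 h3, eq_of_mem_placed_later r hq.1 hg, hj]
  · intro g _
    simp only [coe_sigma, Set.mem_sigma_iff, coe_univ, Set.mem_univ, true_and, mem_coe, mem_filter,
      mem_powerset, subset_iff]
    exact ⟨fun x hx => by simpa using (hf g).1 x hx, (hf g).2.1⟩
end

theorem succeedsS_iff_of_mem_placed {n k M : ℕ} (r : Fin (k * n) → Fin n) {j : Fin n}
    {L : Finset (Fin (k * n))} (hL : ∀ x ∈ L, r x = j) (hne : L.Nonempty)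
    {g : Equiv.Perm (Fin (k * n))} (hg : g ∈ placed (front (k * n) M) L (laterItems r j L)) :
    succeedsS n k M (r ∘ g.symm) ↔
      ∃ t ∈ laterItems r j L, (r t : ℕ) + 1 = n ∧ ∀ s ∈ laterItems r j L, g t ≤ g s := by
  have hmax : firstMax n k M (r ∘ g.symm) = j := by
    refine le_antisymm (Finset.sup_le fun p hp => ?_) ?_
    · refine le_of_mem_placed_later r hL hg ?_
      simpa [front] using hp
    · obtain ⟨x, hx⟩ := hne
      have h1 := (mem_placed.1 hg).1 x hx
      have h2 := hL x hx
      have h3 := Finset.le_sup (f := fun t => (((r ∘ g.symm) t : Fin n) : ℕ))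
        (s := univ.filter (fun t : Fin (k * n) => (t : ℕ) < M)) (b := g x) (by simpa [front] using h1)
      simpa [h2, firstMax] using h3
  have hmem : ∀ x, M ≤ (g x : ℕ) ∧ j ≤ r x ↔ x ∈ laterItems r j L := by
    intro x
    have h1 := (mem_placed.1 hg).1 x
    have h2 := (mem_placed.1 hg).2 x
    simp only [front, laterItems, Finset.mem_sdiff, mem_filter, mem_univ, true_and, not_lt] at h1 h2 ⊢
    constructor
    · rintro ⟨ha, hb⟩
      exact ⟨hb, fun hx => absurd (h1 hx) (by omega)⟩
    · intro h
      exact ⟨h2 h, h.1⟩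
  unfold succeedsS
  rw [hmax, ← g.exists_congr_right]
  simp only [Function.comp_apply, Equiv.symm_apply_apply, Fin.val_fin_le]
  constructor
  · rintro ⟨t, h1, h2, h3, h4⟩
    refine ⟨t, (hmem t).1 ⟨h1, h2⟩, h4, fun s hs => ?_⟩
    have := (hmem s).2 hs
    exact h3 (g s) this.1 (by simpa using this.2)
  · rintro ⟨t, ht, h4, h3⟩
    have := (hmem t).2 ht
    refine ⟨t, this.1, this.2, fun p hp hj => ?_, h4⟩
    simpa using h3 (g.symm p) ((hmem _).1 (by simpa using ⟨hp, hj⟩))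

theorem card_success_of_placed {n k M : ℕ} (r : Fin (k * n) → Fin n) {j : Fin n}
    {L : Finset (Fin (k * n))} (hL : ∀ x ∈ L, r x = j) (hne : L.Nonempty) :
    (#{g ∈ placed (front (k * n) M) L (laterItems r j L) | succeedsS n k M (r ∘ g.symm)} : ℝ)
      = #(placed (front (k * n) M) L (laterItems r j L)) *
        (#{t ∈ laterItems r j L | (r t : ℕ) + 1 = n} / #(laterItems r j L)) := by
  have hdisj : Disjoint L (laterItems r j L) := by
    rw [laterItems]; exact disjoint_sdiff
  refine Eq.trans ?_ (card_filter_exists_first (front (k * n) M) L (laterItems r j L) hdisj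
    fun t => (r t : ℕ) + 1 = n)
  congr 2
  ext g
  simp only [mem_filter]
  exact and_congr_right fun hg => succeedsS_iff_of_mem_placed r hL hne hg

theorem placedProb_mem_Icc {N M l t : ℕ} (hM : M ≤ N) (h : l + t ≤ N) :
    placedProb N M l t ∈ Set.Icc 0 ((1 - (M : ℝ) / N) ^ t) := by
  obtain ⟨L, -, hL⟩ := exists_subset_card_eq (s := (univ : Finset (Fin N))) (n := l)
    (by simp; omega)
  obtain ⟨T, hTL, hT⟩ := exists_subset_card_eq (s := Lᶜ) (n := t)
    (by rw [card_compl, Fintype.card_fin, hL]; omega)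
  have hdisj : Disjoint L T := disjoint_compl_right.mono_right hTL
  have h1 := card_placed (front N M) L T hdisj
  have h2 := card_placed_le (front N M) L T
  rw [Fintype.card_fin, card_front hM, hL, hT] at h1
  rw [Fintype.card_fin, card_front hM, hT, h1] at h2
  have hpos : (0 : ℝ) < N.factorial := by exact_mod_cast N.factorial_pos
  refine ⟨?_, le_of_mul_le_mul_left h2 hpos⟩
  refine nonneg_of_mul_nonneg_right (a := (N.factorial : ℝ)) ?_ hpos
  rw [← h1]; positivity

section
variable {N n k : ℕ} {r : Fin N → Fin n}

theorem card_laterItems (hr : ∀ v, #{i | r i = v} = k) (j : Fin n) {L : Finset (Fin N)}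
    (hL : ∀ x ∈ L, r x = j) : #(laterItems r j L) = k * (j.rev + 1) - #L := by
  rw [laterItems, card_sdiff_of_subset]
  · congr 1
    rw [Finset.card_eq_sum_card_fiberwise (f := r) (t := Finset.Ici j) (by intro x; simp),
      Finset.sum_const_nat (m := k)]
    · rw [Fin.card_Ici, Fin.val_rev, mul_comm]
      congr 1
      omega
    · intro v hv
      rw [← hr v, filter_filter]
      congr 1
      ext x
      simp only [mem_Ici, mem_filter, mem_univ, true_and] at hv ⊢
      exact ⟨fun h => h.2, fun h => ⟨h ▸ hv, h⟩⟩
  · intro x hx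
    simp [hL x hx]

theorem card_top_laterItems (hr : ∀ v, #{i | r i = v} = k) (j : Fin n) {L : Finset (Fin N)}
    (hL : ∀ x ∈ L, r x = j) :
    #{t ∈ laterItems r j L | (r t : ℕ) + 1 = n} = if (j.rev : ℕ) = 0 then k - #L else k := by
  split_ifs with h
  · rw [filter_true_of_mem, card_laterItems hr j hL, h, zero_add, mul_one]
    intro t ht
    simp only [laterItems, Finset.mem_sdiff, mem_filter, mem_univ, true_and, Fin.le_def] at ht
    rw [Fin.val_rev] at h
    omega
  · rw [Fin.val_rev] at h
    rw [← hr ⟨n - 1, by omega⟩]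
    congr 1
    ext t
    simp only [laterItems, Finset.mem_sdiff, mem_filter, mem_univ, true_and, Fin.le_def,
      Fin.ext_iff]
    constructor
    · omega
    · intro ht
      refine ⟨⟨by omega, fun htL => ?_⟩, by omega⟩
      have := congrArg Fin.val (hL t htL)
      omega
end

/-- The conditional probability that the strategy succeeds, given that the largest rank among the
first entries is the one `d` below the top and occurs there `l` times. -/
noncomputable def winRatio (k d l : ℕ) : ℝ :=
  ((if d = 0 then k - l else k : ℕ) : ℝ) / ((k * (d + 1) - l : ℕ) : ℝ)

theorem exists_mem_multisetPerms (n k : ℕ) : ∃ r, r ∈ multisetPerms n k := by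
  refine ⟨fun i => (finProdFinEquiv.symm i).2, ?_⟩
  simp only [multisetPerms, mem_filter, mem_univ, true_and]
  intro v
  rw [← Finset.card_map finProdFinEquiv.symm.toEmbedding]
  trans #((univ : Finset (Fin k)) ×ˢ ({v} : Finset (Fin n)))
  · congr 1
    ext x
    simp only [mem_map_equiv, mem_filter, mem_univ, true_and, Equiv.symm_symm,
      Equiv.symm_apply_apply, mem_product, mem_singleton]
  · simp

theorem probS_eq_sum {n k M : ℕ} (hM1 : 1 ≤ M) (hM2 : M ≤ k * n) :
    probS n k M = ∑ d ∈ range n, ∑ l ∈ range k, (k.choose (l + 1) : ℝ) *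
      (placedProb (k * n) M (l + 1) (k * (d + 1) - (l + 1)) * winRatio k d (l + 1)) := by
  obtain ⟨r, hr⟩ := exists_mem_multisetPerms n k
  have hΩ : ∀ w, w ∈ multisetPerms n k ↔ ∀ v, #{i | w i = v} = k := by simp [multisetPerms]
  rw [hΩ] at hr
  obtain ⟨K, hK0, hK⟩ := exists_card_filter_perm_eq_mul r (fun _ => k) hr _ hΩ
  have hF : (front (k * n) M).Nonempty := card_pos.1 (by rw [card_front hM2]; exact hM1)
  have hK' : (K : ℝ) ≠ 0 := by exact_mod_cast hK0
  have hfac : ((k * n).factorial : ℝ) ≠ 0 := by exact_mod_cast (Nat.factorial_pos _).ne'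
  have h3 : probS n k M
      = (#{g : Equiv.Perm (Fin (k * n)) | succeedsS n k M (r ∘ g.symm)} : ℝ)
        / (k * n).factorial := by
    have h2 := hK fun _ => True
    simp only [filter_true, card_univ, Fintype.card_perm, Fintype.card_fin] at h2
    rw [h2, hK (succeedsS n k M), Nat.cast_mul, Nat.cast_mul, mul_div_mul_right _ _ hK', probS]
  rw [h3, div_eq_iff hfac, card_filter_perm_eq_sum r hF]
  push_cast
  set W : ℕ → ℝ := fun d => ∑ l ∈ range k, (k.choose (l + 1) : ℝ) *
    (placedProb (k * n) M (l + 1) (k * (d + 1) - (l + 1)) * winRatio k d (l + 1)) with hW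
  rw [← Fin.sum_univ_eq_sum_range W n, ← Equiv.sum_comp Fin.revPerm (fun d : Fin n => W d),
    Finset.sum_mul]
  refine Finset.sum_congr rfl fun j _ => ?_
  simp only [Fin.revPerm_apply, hW]
  set G : ℕ → ℝ := fun l => if l = 0 then 0 else (k * n).factorial *
    (placedProb (k * n) M l (k * (j.rev + 1) - l) * winRatio k j.rev l) with hG
  have hterm : ∀ L ∈ (univ.filter fun x => r x = j).powerset,
      (if L.Nonempty then (#{g ∈ placed (front (k * n) M) L (laterItems r j L) |
        succeedsS n k M (r ∘ g.symm)} : ℝ) else 0) = G #L := by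
    intro L hL
    replace hL : ∀ x ∈ L, r x = j := fun x hx => by simpa using mem_powerset.1 hL hx
    rcases L.eq_empty_or_nonempty with rfl | hne
    · simp [hG]
    · rw [if_pos hne, hG]
      simp only [hne.card_pos.ne', if_false]
      rw [card_success_of_placed r hL hne, card_placed _ _ _ (by rw [laterItems]; exact disjoint_sdiff),
        card_top_laterItems hr j hL, card_laterItems hr j hL, Fintype.card_fin, card_front hM2,
        winRatio, mul_assoc]
  rw [Finset.sum_filter, Finset.sum_congr rfl hterm, Finset.sum_powerset_apply_card, hr j,
    Finset.sum_range_succ']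
  simp only [hG, if_true, smul_zero, add_zero, Nat.succ_ne_zero, if_false, nsmul_eq_mul,
    Finset.sum_mul]
  refine Finset.sum_congr rfl fun l _ => ?_
  ring

theorem tendsto_sub_div_sub {x y : ℕ → ℝ} {s : ℝ} (hy : Tendsto y atTop atTop)
    (h : Tendsto (fun n => x n / y n) atTop (nhds s)) (a b : ℝ) :
    Tendsto (fun n => (x n - a) / (y n - b)) atTop (nhds s) := by
  have ha : Tendsto (fun n => a / y n) atTop (nhds 0) := hy.const_div_atTop a
  have hb : Tendsto (fun n => b / y n) atTop (nhds 0) := hy.const_div_atTop b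
  have h1 := (h.sub ha).div (hb.const_sub 1) (by norm_num)
  simp only [sub_zero, div_one] at h1
  refine h1.congr' ?_
  filter_upwards [hy.eventually_gt_atTop 0] with n hn
  simp only [Pi.div_apply]
  rw [← sub_div, one_sub_div hn.ne', div_div_div_cancel_right₀ hn.ne']

theorem tendsto_placedProb {N M : ℕ → ℕ} {c : ℝ} (hN : Tendsto N atTop atTop)
    (h : Tendsto (fun n => (M n : ℝ) / N n) atTop (nhds c)) (l t : ℕ) :
    Tendsto (fun n => placedProb (N n) (M n) l t) atTop (nhds (c ^ l * (1 - c) ^ t)) := by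
  have hN' : Tendsto (fun n => (N n : ℝ)) atTop atTop := tendsto_natCast_atTop_atTop.comp hN
  have h' : Tendsto (fun n => ((N n : ℝ) - M n) / N n) atTop (nhds (1 - c)) := by
    refine (h.const_sub 1).congr' ?_
    filter_upwards [hN'.eventually_gt_atTop 0] with n hn
    rw [sub_div, div_self hn.ne']
  unfold placedProb
  refine Tendsto.mul ?_ ?_
  · simpa using tendsto_finsetProd (range l) fun i _ => tendsto_sub_div_sub hN' h i i
  · simpa [sub_sub] using
      tendsto_finsetProd (range t) fun i _ => tendsto_sub_div_sub hN' h' i (l + i)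

theorem winRatio_mem_Icc {k d l : ℕ} (hl : l ≤ k) : winRatio k d l ∈ Set.Icc 0 1 := by
  refine ⟨by unfold winRatio; positivity, div_le_one_of_le₀ ?_ (by positivity)⟩
  rw [Nat.cast_le]
  split_ifs with h
  · simp [h]
  · have : k * 2 ≤ k * (d + 1) := Nat.mul_le_mul_left k (by omega)
    omega

/-- The limiting probability that the strategy succeeds while the largest rank among the first
entries is the one `d` below the top. -/
noncomputable def limitTerm (c : ℝ) (d : ℕ) : ℝ :=
  ∑ l ∈ range 3, (Nat.choose 3 (l + 1) : ℝ) *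
    (c ^ (l + 1) * (1 - c) ^ (3 * (d + 1) - (l + 1)) * winRatio 3 d (l + 1))

theorem tendsto_probS_tsum (M : ℕ → ℕ) (c : ℝ) (hc : c ∈ Set.Ioo (0 : ℝ) 1)
    (hM : ∀ n, 1 ≤ n → 1 ≤ M n ∧ M n ≤ 3 * n - 1)
    (hlim : Tendsto (fun n : ℕ => (M n : ℝ) / ((3 : ℝ) * n)) atTop (nhds c)) :
    Tendsto (fun n : ℕ => probS n 3 (M n)) atTop (nhds (∑' d, limitTerm c d)) := by
  have hN : Tendsto (fun n : ℕ => 3 * n) atTop atTop :=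
    tendsto_id.const_mul_atTop' (by norm_num)
  have hlim' : Tendsto (fun n : ℕ => (M n : ℝ) / (3 * n : ℕ)) atTop (nhds c) := by
    simpa using hlim
  set f : ℕ → ℕ → ℝ := fun n d => if d < n then ∑ l ∈ range 3, (Nat.choose 3 (l + 1) : ℝ) *
    (placedProb (3 * n) (M n) (l + 1) (3 * (d + 1) - (l + 1)) * winRatio 3 d (l + 1)) else 0
    with hf
  have hprob : ∀ᶠ n in atTop, ∑' d, f n d = probS n 3 (M n) := by
    filter_upwards [eventually_ge_atTop 1] with n hn
    have hMn := hM n hn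
    rw [probS_eq_sum hMn.1 (by omega), tsum_eq_sum (s := range n)]
    · exact Finset.sum_congr rfl fun d hd => by rw [hf]; simp only [mem_range.1 hd, if_true]
    · intro d hd
      rw [mem_range] at hd
      simp [hf, hd]
  refine Tendsto.congr' hprob ?_
  have hb0 : 0 ≤ 1 - c / 2 := by linarith [hc.2]
  have hb1 : 1 - c / 2 < 1 := by linarith [hc.1]
  refine tendsto_tsum_of_dominated_convergence (bound := fun d => 7 * (1 - c / 2) ^ d)
    ((summable_geometric_of_lt_one hb0 hb1).mul_left 7) ?_ ?_
  · intro d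
    have h1 : Tendsto (fun n => ∑ l ∈ range 3, (Nat.choose 3 (l + 1) : ℝ) *
        (placedProb (3 * n) (M n) (l + 1) (3 * (d + 1) - (l + 1)) * winRatio 3 d (l + 1)))
        atTop (nhds (limitTerm c d)) :=
      tendsto_finsetSum _ fun l _ =>
        ((tendsto_placedProb hN hlim' _ _).mul_const _).const_mul _
    refine h1.congr' ?_
    filter_upwards [eventually_gt_atTop d] with n hn
    simp [hf, hn]
  · filter_upwards [hlim'.eventually_const_lt (by linarith [hc.1] : c / 2 < c),
      eventually_ge_atTop 1] with n hn hn1 d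
    have hMn := hM n hn1
    simp only [hf]
    split_ifs with hd
    swap
    · rw [norm_zero]; positivity
    have hterm : ∀ l ∈ range 3, ‖(Nat.choose 3 (l + 1) : ℝ) *
        (placedProb (3 * n) (M n) (l + 1) (3 * (d + 1) - (l + 1)) * winRatio 3 d (l + 1))‖
        ≤ (Nat.choose 3 (l + 1) : ℝ) * (1 - c / 2) ^ d := by
      intro l hl
      rw [mem_range] at hl
      have hw := winRatio_mem_Icc (k := 3) (d := d) (l := l + 1) (by omega)
      have hp := placedProb_mem_Icc (N := 3 * n) (M := M n) (l := l + 1)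
        (t := 3 * (d + 1) - (l + 1)) (by omega) (by omega)
      have hle1 : (M n : ℝ) / (3 * n : ℕ) ≤ 1 :=
        div_le_one_of_le₀ (by exact_mod_cast (by omega : M n ≤ 3 * n)) (by positivity)
      have hq : placedProb (3 * n) (M n) (l + 1) (3 * (d + 1) - (l + 1)) ≤ (1 - c / 2) ^ d :=
        calc _ ≤ _ := hp.2
          _ ≤ (1 - c / 2) ^ (3 * (d + 1) - (l + 1)) :=
            pow_le_pow_left₀ (by linarith) (by linarith) _
          _ ≤ (1 - c / 2) ^ d := pow_le_pow_of_le_one hb0 hb1.le (by omega)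
      rw [Real.norm_of_nonneg (by have := hp.1; have := hw.1; positivity)]
      refine mul_le_mul_of_nonneg_left ?_ (by positivity)
      exact (mul_le_of_le_one_right hp.1 hw.2).trans hq
    refine (norm_sum_le_of_le _ hterm).trans (le_of_eq ?_)
    simp only [Finset.sum_range_succ, Finset.sum_range_zero]
    norm_num [Nat.choose]
    ring

theorem tendsto_sum_range_three {a : ℕ → ℝ} {A : ℝ} (h : HasSum a A) :
    Tendsto (fun D => ∑ d ∈ range D, (a (3 * d) + a (3 * d + 1) + a (3 * d + 2))) atTop
      (nhds A) := by
  refine (h.tendsto_sum_nat.comp (tendsto_id.const_mul_atTop' (by norm_num : 0 < 3))).congr ?_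
  intro D
  simp only [Function.comp_apply, id]
  induction D with
  | zero => simp
  | succ D ih => rw [Finset.sum_range_succ, ← ih, Nat.mul_succ]; simp [Finset.sum_range_succ, add_assoc]

theorem summable_pow_div_three {q : ℝ} (h0 : 0 < q) (h1 : q < 1) (r : ℕ) :
    Summable fun d : ℕ => q ^ (3 * d + r) / (3 * d + r : ℝ) := by
  refine Summable.of_nonneg_of_le (fun d => by positivity) (fun d => ?_)
    (summable_geometric_of_lt_one h0.le h1)
  rcases Nat.eq_zero_or_pos (3 * d + r) with h | h
  · have h' : (3 * d + r : ℝ) = 0 := by exact_mod_cast h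
    rw [h', div_zero]; positivity
  · have h' : (1 : ℝ) ≤ 3 * d + r := by exact_mod_cast h
    exact (div_le_self (by positivity) h').trans
      (pow_le_pow_of_le_one h0.le h1.le (by omega))

theorem hasSum_pow_three_div {q : ℝ} (h0 : 0 < q) (h1 : q < 1) :
    HasSum (fun d : ℕ => q ^ (3 * (d + 1)) / ((d : ℝ) + 1)) (-Real.log (1 - q ^ 3)) := by
  have h := Real.hasSum_pow_div_log_of_abs_lt_one (x := q ^ 3)
    (by rw [abs_of_pos (by positivity)]; exact pow_lt_one₀ h0.le h1 (by norm_num))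
  simpa only [← pow_mul] using h

theorem tsum_pow_div_three_add {q : ℝ} (h0 : 0 < q) (h1 : q < 1) :
    (∑' d : ℕ, q ^ (3 * d + 1) / (3 * d + (1 : ℕ) : ℝ))
      + ∑' d : ℕ, q ^ (3 * d + 2) / (3 * d + (2 : ℕ) : ℝ)
      = -Real.log (1 - q) + Real.log (1 - q ^ 3) / 3 := by
  have hS := Real.hasSum_pow_div_log_of_abs_lt_one (x := q) (by rwa [abs_of_pos h0])
  have h2 := tendsto_sum_range_three hS
  have h3 := ((hasSum_pow_three_div h0 h1).div_const 3).add
    (((summable_pow_div_three h0 h1 1).hasSum).add ((summable_pow_div_three h0 h1 2).hasSum))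
  have h4 := tendsto_nhds_unique h2 (h3.tendsto_sum_nat.congr fun D =>
    Finset.sum_congr rfl fun d _ => ?_)
  · linarith
  · push_cast
    have : ((3 : ℝ) * d + 2 + 1) = 3 * (d + 1) := by ring
    rw [this, show 3 * d + 2 + 1 = 3 * (d + 1) by ring]
    have e1 : ((3 : ℝ) * d + 1 + 1) = 3 * d + 2 := by ring
    rw [e1]
    field_simp
    ring

theorem tsum_pow_div_three_sub {q : ℝ} (h0 : 0 < q) (h1 : q < 1) :
    (∑' d : ℕ, q ^ (3 * d + 1) / (3 * d + (1 : ℕ) : ℝ))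
      - ∑' d : ℕ, q ^ (3 * d + 2) / (3 * d + (2 : ℕ) : ℝ)
      = 2 / √3 * Real.arctan (√3 * q / (2 + q)) := by
  have h3 : √3 * √3 = 3 := Real.mul_self_sqrt (by norm_num)
  have h3pos : 0 < √3 := Real.sqrt_pos.2 (by norm_num)
  set w : ℂ := ⟨-1 / 2, √3 / 2⟩ with hw
  have hw2 : w ^ 2 = ⟨-1 / 2, -(√3 / 2)⟩ := by
    rw [sq]; apply Complex.ext <;> simp [hw] <;> nlinarith
  have hw3 : w ^ 3 = 1 := by
    rw [pow_succ, hw2]; apply Complex.ext <;> simp [hw] <;> nlinarith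
  set z : ℂ := w * q with hz
  have hnorm : ‖z‖ < 1 := by
    have : ‖w‖ = 1 := by
      have : ‖w‖ ^ 3 = 1 := by rw [← norm_pow, hw3, norm_one]
      exact (pow_eq_one_iff_of_nonneg (norm_nonneg _) (by norm_num)).1 this
    rw [hz, norm_mul, this, one_mul, Complex.norm_real, Real.norm_of_nonneg h0.le]
    exact h1
  have hS := Complex.hasSum_im (Complex.hasSum_taylorSeries_neg_log hnorm)
  have hlim := tendsto_sum_range_three hS
  have hT := (((summable_pow_div_three h0 h1 1).hasSum).sub
    ((summable_pow_div_three h0 h1 2).hasSum)).mul_left (√3 / 2)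
  have harg : (-Complex.log (1 - z)).im = Real.arctan (√3 * q / (2 + q)) := by
    have hre : (1 - z).re = (2 + q) / 2 := by simp [hz, hw]; ring
    have him : (1 - z).im = -(√3 * q / 2) := by simp [hz, hw]; ring
    have habs : |(1 - z).arg| < Real.pi / 2 :=
      Complex.abs_arg_lt_pi_div_two_iff.2 (Or.inl (by rw [hre]; linarith))
    rw [abs_lt] at habs
    rw [Complex.neg_im, Complex.log_im, ← Real.arctan_tan habs.1 habs.2, Complex.tan_arg, hre, him,
      ← Real.arctan_neg]
    congr 1
    field_simp
  have hpow : ∀ n : ℕ, (z ^ n / n : ℂ).im = (w ^ n).im * (q ^ n / n) := by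
    intro n
    rw [hz, mul_pow, mul_div_assoc]
    have : ((q : ℂ) ^ n / n) = ((q ^ n / n : ℝ) : ℂ) := by push_cast; rfl
    rw [this, Complex.im_mul_ofReal]
  have h4 := tendsto_nhds_unique hlim (hT.tendsto_sum_nat.congr fun D =>
    Finset.sum_congr rfl fun d _ => ?_)
  · rw [harg] at h4
    rw [h4]
    field_simp
  · rw [hpow, hpow, hpow, pow_add w, pow_add w, pow_mul w, hw3, one_pow, one_mul, one_mul, pow_one,
      hw2]
    simp [hw]
    ring

theorem arctan_three_sub_two_mul_div {q : ℝ} (h0 : 0 < q) :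
    Real.arctan ((1 + 2 * q) / √3) = Real.pi / 6 + Real.arctan (√3 * q / (2 + q)) := by
  have h3 : √3 * √3 = 3 := Real.mul_self_sqrt (by norm_num)
  have h3pos : 0 < √3 := Real.sqrt_pos.2 (by norm_num)
  have h6 : Real.arctan (1 / √3) = Real.pi / 6 := by
    rw [← Real.tan_pi_div_six]
    exact Real.arctan_tan (by linarith [Real.pi_pos]) (by linarith [Real.pi_pos])
  have hxy : 1 / √3 * (√3 * q / (2 + q)) = q / (2 + q) := by field_simp
  rw [← h6, Real.arctan_add (by rw [hxy, div_lt_one] <;> linarith), hxy]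
  congr 1
  have : 1 - q / (2 + q) = 2 / (2 + q) := by field_simp; ring
  rw [this]
  field_simp
  nlinarith

theorem hasSum_limitTerm {c : ℝ} (hc : c ∈ Set.Ioo (0 : ℝ) 1) :
    HasSum (limitTerm c) (-(3/2) * (1-c) * c * (1 + 3*c)
        - (3*c + 3*c^2 + c^3) * Real.log c
        + ((3/2)*c + (3/2)*c^2 - c^3) * Real.log (c^2 - 3*c + 3)
        + 3 * Real.sqrt 3 * (-c + c^2) * Real.arctan ((3 - 2*c) / Real.sqrt 3)
        + (Real.sqrt 3 * Real.pi / 2) * (c - c^2)) := by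
  obtain ⟨q, rfl⟩ : ∃ q, c = 1 - q := ⟨1 - c, by ring⟩
  have h0 : 0 < q := by linarith [hc.2]
  have h1 : q < 1 := by linarith [hc.1]
  have hlog : Real.log (1 - q ^ 3) = Real.log (1 - q) + Real.log ((1-q)^2 - 3*(1-q) + 3) := by
    rw [← Real.log_mul (by linarith) (by nlinarith)]
    congr 1; ring
  have hadd := tsum_pow_div_three_add h0 h1
  have hsub := tsum_pow_div_three_sub h0 h1
  have hs1 := (hasSum_nat_add_iff' 1).2 (summable_pow_div_three h0 h1 1).hasSum
  have hs2 := (hasSum_nat_add_iff' 1).2 (summable_pow_div_three h0 h1 2).hasSum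
  set s1 := ∑' d : ℕ, q ^ (3 * d + 1) / (3 * d + (1 : ℕ) : ℝ)
  set s2 := ∑' d : ℕ, q ^ (3 * d + 2) / (3 * d + (2 : ℕ) : ℝ)
  have hs0 := hasSum_pow_three_div h0 h1
  have hsum := ((hs2.mul_left (9 * (1 - q))).add (hs1.mul_left (9 * (1 - q) ^ 2))).add
    (hs0.mul_left ((1 - q) ^ 3))
  have hfun : ∀ d, limitTerm (1 - q) (d + 1)
      = 9 * (1 - q) * (q ^ (3 * (d + 1) + 2) / (3 * (d + 1 : ℕ) + (2 : ℕ) : ℝ))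
        + 9 * (1 - q) ^ 2 * (q ^ (3 * (d + 1) + 1) / (3 * (d + 1 : ℕ) + (1 : ℕ) : ℝ))
        + (1 - q) ^ 3 * (q ^ (3 * (d + 1)) / ((d : ℝ) + 1)) := by
    intro d
    simp only [limitTerm, winRatio, Finset.sum_range_succ, Finset.sum_range_zero]
    rw [show 3 * (d + 1 + 1) - (0 + 1) = 3 * (d + 1) + 2 by omega,
      show 3 * (d + 1 + 1) - (1 + 1) = 3 * (d + 1) + 1 by omega,
      show 3 * (d + 1 + 1) - (2 + 1) = 3 * (d + 1) by omega]
    norm_num [Nat.choose]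
    field_simp
    ring
  rw [← funext hfun] at hsum
  refine (hasSum_nat_add_iff' 1).1 (Eq.subst (motive := fun v => HasSum _ v) ?_ hsum)
  have h3 : √3 * √3 = 3 := Real.mul_self_sqrt (by norm_num)
  have h3pos : 0 < √3 := Real.sqrt_pos.2 (by norm_num)
  have hat := arctan_three_sub_two_mul_div h0
  have e : (3 - 2 * (1 - q)) = 1 + 2 * q := by ring
  rw [e, hat, hlog]
  rw [hlog] at hadd
  have h23 : 2 / √3 = 2 * √3 / 3 := by
    rw [div_eq_div_iff h3pos.ne' (by norm_num)]; linarith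
  rw [h23] at hsub
  have hs1' : s1 = ((-Real.log (1 - q) + (Real.log (1 - q)
      + Real.log ((1 - q) ^ 2 - 3 * (1 - q) + 3)) / 3)
      + 2 * √3 / 3 * Real.arctan (√3 * q / (2 + q))) / 2 := by linarith
  have hs2' : s2 = ((-Real.log (1 - q) + (Real.log (1 - q)
      + Real.log ((1 - q) ^ 2 - 3 * (1 - q) + 3)) / 3)
      - 2 * √3 / 3 * Real.arctan (√3 * q / (2 + q))) / 2 := by linarith
  rw [hs1', hs2']
  simp only [limitTerm, winRatio, Finset.sum_range_succ, Finset.sum_range_zero]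
  norm_num [Nat.choose]
  ring

/-- The case `k = 3` of Theorem 1. -/
theorem secretary_multirank_limit_three (M : ℕ → ℕ) (c : ℝ) (hc : c ∈ Set.Ioo (0:ℝ) 1)
    (hM : ∀ n, 1 ≤ n → 1 ≤ M n ∧ M n ≤ 3*n - 1)
    (hlim : Tendsto (fun n : ℕ => (M n : ℝ) / ((3 : ℝ) * n)) atTop (nhds c)) :
    Tendsto (fun n : ℕ => probS n 3 (M n)) atTop
      (nhds (-(3/2) * (1-c) * c * (1 + 3*c)
        - (3*c + 3*c^2 + c^3) * Real.log c
        + ((3/2)*c + (3/2)*c^2 - c^3) * Real.log (c^2 - 3*c + 3)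
        + 3 * Real.sqrt 3 * (-c + c^2) * Real.arctan ((3 - 2*c) / Real.sqrt 3)
        + (Real.sqrt 3 * Real.pi / 2) * (c - c^2))) := by
  rw [← (hasSum_limitTerm hc).tsum_eq]
  exact tendsto_probS_tsum M c hc hM hlim
end

section
/- For integers k ≥ 2, n ≥ 1 and 1 ≤ M ≤ kn−1, the probability of selecting an item of highest rank using strategy S⁺(n,k;M) equals Σ_{j=1}^{n−1} Σ_{l=1}^{k} [C(M,l)·(k)_l·(k(j−1))_{M−l}] / (kn)_M · 1/(n−j), where any falling factorial (b)_a with a > b is interpreted as 0. -/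
open Finset Filter

open scoped Classical

theorem Nat.sum_choose_mul_descFactorial_mul_descFactorial (a b M : ℕ) :
    ∑ l ∈ range (M + 1), M.choose l * a.descFactorial l * b.descFactorial (M - l) =
      (a + b).descFactorial M := by
  rw [Nat.descFactorial_eq_factorial_mul_choose, Nat.add_choose_eq,
    Finset.Nat.sum_antidiagonal_eq_sum_range_succ_mk, mul_sum]
  refine sum_congr rfl fun l hl => ?_
  rw [Nat.descFactorial_eq_factorial_mul_choose, Nat.descFactorial_eq_factorial_mul_choose,
    ← Nat.choose_mul_factorial_mul_factorial (mem_range_succ_iff.mp hl)]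
  ring

theorem Nat.sum_Icc_choose_mul_descFactorial_mul_descFactorial (a b M : ℕ) :
    ∑ l ∈ Icc 1 a, M.choose l * a.descFactorial l * b.descFactorial (M - l)
      + b.descFactorial M = (a + b).descFactorial M := by
  set f : ℕ → ℕ := fun l => M.choose l * a.descFactorial l * b.descFactorial (M - l) with hf
  have h1 : ∑ l ∈ range (a + 1), f l = ∑ l ∈ range (M + 1), f l := by
    have hM : ∀ l, M < l → f l = 0 := fun l hl => by simp [hf, Nat.choose_eq_zero_of_lt hl]
    have ha : ∀ l, a < l → f l = 0 := fun l hl => by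
      simp [hf, Nat.descFactorial_eq_zero_iff_lt.mpr hl]
    rcases le_total a M with h | h
    · refine sum_subset (range_subset_range.mpr (by omega)) fun l _ hl => ha l ?_
      simpa using hl
    · refine (sum_subset (range_subset_range.mpr (by omega)) fun l _ hl => hM l ?_).symm
      simpa using hl
  rw [← Nat.sum_choose_mul_descFactorial_mul_descFactorial, ← h1, sum_range_succ', range_eq_Ico,
    sum_Ico_add' f 0 a 1]
  simp [hf, Ico_add_one_right_eq_Icc]

/-- The arrangements whose first `M` entries are all (as `0`-based values) less than `j`. -/
def permsFirstLT (n k M j : ℕ) : Finset (Fin (k*n) → Fin n) :=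
  (multisetPerms n k).filter fun w => ∀ i : Fin (k*n), (i : ℕ) < M → (w i : ℕ) < j

theorem mem_multisetPerms {n k : ℕ} {w : Fin (k*n) → Fin n} :
    w ∈ multisetPerms n k ↔ ∀ v, #{i | w i = v} = k := by
  simp [multisetPerms]

theorem comp_equiv_mem_multisetPerms {n k : ℕ} {w : Fin (k*n) → Fin n}
    (hw : w ∈ multisetPerms n k) (e : Equiv.Perm (Fin (k*n))) :
    w ∘ e ∈ multisetPerms n k := by
  rw [mem_multisetPerms] at hw ⊢
  intro v
  exact (card_equiv e (by simp)).trans (hw v)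

theorem equiv_comp_mem_multisetPerms {n k : ℕ} {w : Fin (k*n) → Fin n}
    (hw : w ∈ multisetPerms n k) (e : Equiv.Perm (Fin n)) :
    e ∘ w ∈ multisetPerms n k := by
  rw [mem_multisetPerms] at hw ⊢
  intro v
  refine (congrArg card ?_).trans (hw (e.symm v))
  ext i
  simp [Equiv.eq_symm_apply]

theorem multisetPerms_nonempty (n k : ℕ) : (multisetPerms n k).Nonempty := by
  refine ⟨fun i => (finProdFinEquiv.symm i).2, mem_multisetPerms.mpr fun v => ?_⟩
  calc _ = #(univ.filter fun p : Fin k × Fin n => p.2 = v) :=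
        card_equiv finProdFinEquiv.symm (by simp)
    _ = #((univ : Finset (Fin k)) ×ˢ {v}) := by
        congr 1
        ext p
        simp [-product_singleton]
    _ = k := by simp

theorem card_filter_val_lt_of_mem_multisetPerms {n k j : ℕ} (hj : j ≤ n)
    {w : Fin (k*n) → Fin n} (hw : w ∈ multisetPerms n k) :
    #{i | (w i : ℕ) < j} = k * j := by
  rw [mem_multisetPerms] at hw
  rw [card_eq_sum_card_fiberwise (f := w) (t := univ.filter fun v : Fin n => (v : ℕ) < j)
    (fun i hi => by simpa using hi)]
  have : ∀ v ∈ univ.filter fun v : Fin n => (v : ℕ) < j,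
      #{i ∈ univ.filter (fun i => (w i : ℕ) < j) | w i = v} = k := by
    intro v hv
    refine (congrArg card ?_).trans (hw v)
    ext i
    simp only [mem_filter, mem_univ, true_and] at hv ⊢
    constructor
    · exact fun h => h.2
    · rintro rfl
      exact ⟨hv, rfl⟩
  rw [sum_congr rfl this, sum_const, Fin.card_filter_val_lt]
  simp [hj, mul_comm]

theorem card_filter_ge_of_mem_permsFirstLT {n k M j : ℕ} (hj : j ≤ n) (hM : M ≤ k * n)
    {w : Fin (k*n) → Fin n} (hw : w ∈ permsFirstLT n k M j) :
    #{i ∈ univ.filter (fun i : Fin (k*n) => M ≤ (i : ℕ)) | (w i : ℕ) < j} = k * j - M := by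
  obtain ⟨hw, hlt⟩ := mem_filter.mp hw
  have h1 := card_filter_val_lt_of_mem_multisetPerms hj hw
  rw [← card_filter_add_card_filter_not (fun i : Fin (k*n) => M ≤ (i : ℕ)),
    filter_filter] at h1
  rw [filter_filter]
  simp only [and_comm (a := M ≤ _)]
  have h2 : #{i ∈ univ.filter (fun i : Fin (k*n) => (w i : ℕ) < j) |
      ¬ M ≤ ((i : Fin (k*n)) : ℕ)} = M := by
    trans #(univ.filter fun i : Fin (k*n) => (i : ℕ) < M)
    · refine congrArg card ?_
      ext i
      simpa using hlt i
    · simp [Fin.card_filter_val_lt, hM]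
  omega

theorem card_permsFirstLT_succ {n k M j : ℕ} (hj : j ≤ n) (hM : M < k * n) :
    #(permsFirstLT n k (M + 1) j) * (k * n - M) = #(permsFirstLT n k M j) * (k * j - M) := by
  have hdc := sum_card_bipartiteAbove_eq_sum_card_bipartiteBelow
    (s := permsFirstLT n k M j) (t := univ.filter fun i : Fin (k*n) => M ≤ (i : ℕ))
    (fun w i => (w i : ℕ) < j)
  have hA : ∀ w ∈ permsFirstLT n k M j,
      #(bipartiteAbove (fun (w : Fin (k*n) → Fin n) i => (w i : ℕ) < j)
        (univ.filter fun i : Fin (k*n) => M ≤ (i : ℕ)) w) = k * j - M := fun w hw =>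
    card_filter_ge_of_mem_permsFirstLT hj hM.le hw
  have hB : ∀ i ∈ univ.filter (fun i : Fin (k*n) => M ≤ (i : ℕ)),
      #(bipartiteBelow (fun (w : Fin (k*n) → Fin n) i => (w i : ℕ) < j)
        (permsFirstLT n k M j) i) = #(permsFirstLT n k (M + 1) j) := by
    intro i hi
    have hi : M ≤ (i : ℕ) := by simpa using hi
    let p : Fin (k*n) := ⟨M, hM⟩
    have hfix : ∀ t : Fin (k*n), (t : ℕ) < M → Equiv.swap p i t = t := fun t ht =>
      Equiv.swap_apply_of_ne_of_ne (by rintro rfl; simp [p] at ht) (by rintro rfl; omega)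
    refine card_equiv (Equiv.arrowCongr (Equiv.swap p i) (Equiv.refl _)) fun w => ?_
    have hw' : Equiv.arrowCongr (Equiv.swap p i) (Equiv.refl _) w = w ∘ Equiv.swap p i := by
      ext t
      simp
    rw [hw']
    simp only [bipartiteBelow, permsFirstLT, mem_filter, Function.comp_apply]
    constructor
    · rintro ⟨⟨hw, hlt⟩, hwi⟩
      refine ⟨comp_equiv_mem_multisetPerms hw _, fun t ht => ?_⟩
      rcases Nat.lt_succ_iff_lt_or_eq.mp ht with ht | ht
      · rw [hfix t ht]
        exact hlt t ht
      · obtain rfl : t = p := Fin.ext ht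
        simpa using hwi
    · rintro ⟨hw, hlt⟩
      refine ⟨⟨?_, fun t ht => ?_⟩, ?_⟩
      · have := comp_equiv_mem_multisetPerms hw (Equiv.swap p i)
        simpa [Function.comp_assoc, ← Equiv.coe_trans] using this
      · simpa [hfix t ht] using hlt t (by omega)
      · simpa using hlt p (by simp [p])
  rw [sum_congr rfl hA, sum_congr rfl hB, sum_const, sum_const] at hdc
  have hcard : #(univ.filter fun i : Fin (k*n) => M ≤ (i : ℕ)) = k * n - M := by
    have h := card_filter_add_card_filter_not (s := univ) (fun i : Fin (k*n) => (i : ℕ) < M)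
    simp only [not_lt, Fin.card_filter_val_lt, card_univ, Fintype.card_fin] at h
    omega
  rw [hcard] at hdc
  simp only [smul_eq_mul] at hdc
  rw [hdc, mul_comm]

theorem card_permsFirstLT_mul_descFactorial {n k M j : ℕ} (hj : j ≤ n) (hM : M ≤ k * n) :
    #(permsFirstLT n k M j) * (k * n).descFactorial M =
      #(multisetPerms n k) * (k * j).descFactorial M := by
  induction M with
  | zero => simp [permsFirstLT]
  | succ M ih =>
    have h := card_permsFirstLT_succ hj hM
    rw [Nat.descFactorial_succ, Nat.descFactorial_succ, ← mul_assoc, h, mul_right_comm,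
      ih (by omega)]
    ring

theorem firstMax_lt_iff {n k M j : ℕ} (hM : 1 ≤ M) (hkn : 0 < k * n) (w : Fin (k*n) → Fin n) :
    firstMax n k M w < j ↔ ∀ i : Fin (k*n), (i : ℕ) < M → (w i : ℕ) < j := by
  rcases Nat.eq_zero_or_pos j with rfl | hj
  · simp only [not_lt_zero, imp_false, false_iff, not_forall, not_not]
    exact ⟨⟨0, hkn⟩, by simpa using Nat.succ_le_iff.mp hM⟩
  · simp [firstMax, Finset.sup_lt_iff (bot_lt_iff_ne_bot.mpr hj.ne')]

theorem card_filter_firstMax_eq {n k M : ℕ} (m : ℕ) (hM : 1 ≤ M) (hkn : 0 < k * n) :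
    #{w ∈ multisetPerms n k | firstMax n k M w = m} + #(permsFirstLT n k M m) =
      #(permsFirstLT n k M (m + 1)) := by
  simp only [permsFirstLT, ← firstMax_lt_iff hM hkn]
  rw [← card_union_of_disjoint, ← filter_or]
  · congr 1
    ext w
    simp only [mem_filter]
    refine and_congr_right fun _ => ?_
    omega
  · rw [disjoint_filter]
    intro w _ h1 h2
    omega

/-- The arrangements with `firstMax` equal to `m` for which the first later entry
exceeding `m` equals `v`. -/
def permsFirstExceed (n k M m : ℕ) (v : Fin n) : Finset (Fin (k*n) → Fin n) :=
  (multisetPerms n k).filter fun w => firstMax n k M w = m ∧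
    ∃ i : Fin (k*n), M ≤ (i : ℕ) ∧ m < (w i : ℕ) ∧
      (∀ i' : Fin (k*n), M ≤ (i' : ℕ) → m < (w i' : ℕ) → i ≤ i') ∧ w i = v

theorem le_firstMax {n k M : ℕ} (w : Fin (k*n) → Fin n) {i : Fin (k*n)} (hi : (i : ℕ) < M) :
    (w i : ℕ) ≤ firstMax n k M w :=
  Finset.le_sup (f := fun t => (w t : ℕ)) (by simpa using hi)

theorem swap_comp_mem_permsFirstExceed {n k M m : ℕ} {u v : Fin n} (hu : m < (u : ℕ))
    (hv : m < (v : ℕ)) {w : Fin (k*n) → Fin n} (hw : w ∈ permsFirstExceed n k M m u) :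
    Equiv.swap u v ∘ w ∈ permsFirstExceed n k M m v := by
  simp only [permsFirstExceed, mem_filter] at hw ⊢
  obtain ⟨hw, hmax, i, hi, hmi, hfirst, hiu⟩ := hw
  have hgt : ∀ a : Fin n, m < (Equiv.swap u v a : ℕ) ↔ m < (a : ℕ) := by
    intro a
    rw [Equiv.swap_apply_def]
    split_ifs with h1 h2
    · simp [h1, hu, hv]
    · simp [h2, hu, hv]
    · rfl
  refine ⟨equiv_comp_mem_multisetPerms hw _, ?_, i, hi, by simpa [hgt] using hmi, ?_,
    by simp [hiu]⟩
  · rw [← hmax]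
    refine Finset.sup_congr rfl fun t ht => ?_
    have hle := le_firstMax w (by simpa using ht : (t : ℕ) < M)
    rw [Function.comp_apply, Equiv.swap_apply_of_ne_of_ne]
    · rintro rfl
      omega
    · rintro rfl
      omega
  · simpa [hgt] using hfirst

theorem card_permsFirstExceed_eq {n k M m : ℕ} {u v : Fin n} (hu : m < (u : ℕ))
    (hv : m < (v : ℕ)) :
    #(permsFirstExceed n k M m u) = #(permsFirstExceed n k M m v) := by
  have key : ∀ u v : Fin n, m < (u : ℕ) → m < (v : ℕ) →
      #(permsFirstExceed n k M m u) ≤ #(permsFirstExceed n k M m v) := fun u v hu hv =>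
    card_le_card_of_injOn (Equiv.swap u v ∘ ·)
      (fun w hw => swap_comp_mem_permsFirstExceed hu hv hw)
      ((Equiv.swap u v).injective.comp_left.injOn)
  exact le_antisymm (key u v hu hv) (key v u hv hu)

theorem filter_firstMax_eq_biUnion {n k M m : ℕ} (hk : 0 < k) (hm : m + 1 < n) :
    {w ∈ multisetPerms n k | firstMax n k M w = m} =
      (univ.filter fun v : Fin n => m < (v : ℕ)).biUnion (permsFirstExceed n k M m) := by
  ext w
  simp only [mem_filter, mem_biUnion, permsFirstExceed, mem_univ, true_and]
  constructor
  · rintro ⟨hw, hmax⟩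
    obtain ⟨i, hi⟩ : (univ.filter fun i => w i = ⟨m + 1, hm⟩).Nonempty := by
      rw [← card_pos, mem_multisetPerms.mp hw]
      exact hk
    have hi : w i = ⟨m + 1, hm⟩ := by simpa using hi
    have hgt : m < (w i : ℕ) := by simp [hi]
    have hMi : M ≤ (i : ℕ) := by
      by_contra! h
      have := le_firstMax w h
      omega
    obtain ⟨p, hp, hmin⟩ := exists_min_image
      (univ.filter fun t : Fin (k*n) => M ≤ (t : ℕ) ∧ m < (w t : ℕ)) id
      ⟨i, by simp [hMi, hgt]⟩
    simp only [mem_filter, mem_univ, true_and, id] at hp hmin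
    exact ⟨w p, hp.2, hw, hmax, p, hp.1, hp.2, fun t h1 h2 => hmin t ⟨h1, h2⟩, rfl⟩
  · rintro ⟨v, -, hw, hmax, -⟩
    exact ⟨hw, hmax⟩

theorem card_permsFirstExceed_mul {n k M m : ℕ} (hk : 0 < k) (hm : m + 1 < n) {u : Fin n}
    (hu : m < (u : ℕ)) :
    #(permsFirstExceed n k M m u) * (n - (m + 1)) =
      #{w ∈ multisetPerms n k | firstMax n k M w = m} := by
  rw [filter_firstMax_eq_biUnion hk hm, card_biUnion]
  · rw [sum_congr rfl fun v hv => card_permsFirstExceed_eq (by simpa using hv) hu, sum_const,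
      smul_eq_mul, mul_comm]
    congr 1
    have h := card_filter_add_card_filter_not (s := univ) (fun v : Fin n => (v : ℕ) < m + 1)
    simp only [not_lt, Fin.card_filter_val_lt, card_univ, Fintype.card_fin, Nat.succ_le_iff] at h
    omega
  · intro v _ v' _ hvv'
    refine disjoint_left.mpr fun w hw hw' => ?_
    simp only [permsFirstExceed, mem_filter] at hw hw'
    obtain ⟨-, -, i, hi, hmi, hfirst, rfl⟩ := hw
    obtain ⟨-, -, i', hi', hmi', hfirst', rfl⟩ := hw'
    exact hvv' (congrArg w (le_antisymm (hfirst i' hi' hmi') (hfirst' i hi hmi)))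

theorem card_filter_succeedsSplus {n k M : ℕ} (hn : 1 ≤ n) :
    #{w ∈ multisetPerms n k | succeedsSplus n k M w} =
      ∑ m ∈ range (n - 1), #(permsFirstExceed n k M m ⟨n - 1, by omega⟩) := by
  rw [card_eq_sum_card_fiberwise (f := firstMax n k M) (t := range (n - 1))]
  · refine sum_congr rfl fun m _ => congrArg card ?_
    ext w
    rw [mem_filter, mem_filter, permsFirstExceed, mem_filter]
    simp only [succeedsSplus, Fin.ext_iff]
    constructor
    · rintro ⟨⟨hw, i, h1, h2, h3, h4⟩, rfl⟩
      exact ⟨hw, rfl, i, h1, h2, h3, by omega⟩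
    · rintro ⟨hw, rfl, i, h1, h2, h3, h4⟩
      exact ⟨⟨hw, i, h1, h2, h3, by omega⟩, rfl⟩
  · intro w hw
    obtain ⟨-, i, -, h2, -, h4⟩ := mem_filter.mp hw
    simp only [coe_range, Set.mem_Iio]
    omega

/-- Proposition 2: exact formula for the success probability of `S⁺(n,k;M)`. -/
theorem secretary_multirank_formula_plus (n k M : ℕ) (hk : 2 ≤ k) (hn : 1 ≤ n)
    (hM1 : 1 ≤ M) (hM2 : M ≤ k*n - 1) :
    probSplus n k M =
      ∑ j ∈ Finset.Icc 1 (n-1), ∑ l ∈ Finset.Icc 1 k,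
        ((M.choose l : ℝ) * (Nat.descFactorial k l : ℝ)
            * (Nat.descFactorial (k*(j-1)) (M-l) : ℝ))
          / (Nat.descFactorial (k*n) M : ℝ)
        * (1 / ((n : ℝ) - (j : ℝ))) := by
  have hkn : 0 < k * n := by positivity
  have hMkn : M ≤ k * n := by omega
  have hΩ : (#(multisetPerms n k) : ℝ) ≠ 0 := by
    exact_mod_cast (card_pos.mpr (multisetPerms_nonempty n k)).ne'
  have hD : ((k * n).descFactorial M : ℝ) ≠ 0 := by
    exact_mod_cast (Nat.descFactorial_pos.mpr hMkn).ne'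
  rw [probSplus, card_filter_succeedsSplus hn, Nat.cast_sum, sum_div, range_eq_Ico,
    ← Ico_add_one_right_eq_Icc, ← sum_Ico_add' _ 0 (n - 1) 1]
  refine sum_congr rfl fun m hm => ?_
  have hm : m + 1 < n := by
    have := (mem_Ico.mp hm).2
    omega
  rw [← sum_mul, ← sum_div]
  have h1 := card_permsFirstExceed_mul (M := M) (by omega : 0 < k) hm
    (u := ⟨n - 1, by omega⟩) (by simp; omega)
  have h2 := card_filter_firstMax_eq (n := n) (k := k) m hM1 hkn
  have h3 := card_permsFirstLT_mul_descFactorial (n := n) (j := m) (by omega) hMkn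
  have h4 := card_permsFirstLT_mul_descFactorial (n := n) (j := m + 1) hm.le hMkn
  have h5 := Nat.sum_Icc_choose_mul_descFactorial_mul_descFactorial k (k * m) M
  rw [show k + k * m = k * (m + 1) by ring] at h5
  rw [← h1] at h2
  have hnm : (n : ℝ) - ((m + 1 : ℕ) : ℝ) ≠ 0 := by
    rw [sub_ne_zero]
    exact_mod_cast hm.ne'
  rw [div_mul_div_comm, div_eq_div_iff hΩ (mul_ne_zero hD hnm), Nat.add_sub_cancel]
  rw [← Nat.cast_sub hm.le]
  norm_cast
  zify at h2 h3 h4 h5 ⊢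
  linear_combination ((k * n).descFactorial M : ℤ) * h2 - h3 + h4
    - (#(multisetPerms n k) : ℤ) * h5
end

section
/- For integers k ≥ 2, n ≥ 2, 1 ≤ M ≤ kn−1, 1 ≤ j ≤ n−1 and 1 ≤ l ≤ k, whenever the event A^{(n)}_{M,j,l} has positive probability, the conditional probability under P_{n,k} that strategy S(n,k;M) succeeds given A^{(n)}_{M,j,l} equals k/(k(n−j+1)−l). -/
open Finset Filter

open scoped Classical

/-- The positions beyond the first `M` entries that carry a rank at least `j`. -/
def laterCandidates (n k M j : ℕ) (w : Fin (k*n) → Fin n) : Finset (Fin (k*n)) :=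
  Finset.univ.filter (fun i => M ≤ (i : ℕ) ∧ j ≤ (w i : ℕ) + 1)

lemma mem_laterCandidates {n k M j : ℕ} {w : Fin (k*n) → Fin n} {i : Fin (k*n)} :
    i ∈ laterCandidates n k M j w ↔ M ≤ (i : ℕ) ∧ j ≤ (w i : ℕ) + 1 := by
  simp [laterCandidates]

lemma comp_perm_mem_multisetPerms {n k : ℕ} {w : Fin (k*n) → Fin n}
    (hw : w ∈ multisetPerms n k) (σ : Equiv.Perm (Fin (k*n))) :
    w ∘ σ ∈ multisetPerms n k := by
  simp only [multisetPerms, Finset.mem_filter, Finset.mem_univ, true_and] at hw ⊢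
  intro v
  refine Eq.trans ?_ (hw v)
  exact Finset.card_equiv σ (by simp)

lemma comp_swap_apply_of_lt {n k M j : ℕ} {w : Fin (k*n) → Fin n} {a b : Fin (k*n)}
    (ha : a ∈ laterCandidates n k M j w) (hb : b ∈ laterCandidates n k M j w)
    {i : Fin (k*n)} (hi : (i : ℕ) < M) : (w ∘ Equiv.swap a b) i = w i := by
  rw [mem_laterCandidates] at ha hb
  have h1 : i ≠ a := by rintro rfl; omega
  have h2 : i ≠ b := by rintro rfl; omega
  simp [Equiv.swap_apply_of_ne_of_ne h1 h2]

lemma eventA_comp_swap {n k M j l : ℕ} {w : Fin (k*n) → Fin n} {a b : Fin (k*n)}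
    (ha : a ∈ laterCandidates n k M j w) (hb : b ∈ laterCandidates n k M j w)
    (hw : eventA n k M j l w) : eventA n k M j l (w ∘ Equiv.swap a b) := by
  refine ⟨?_, fun i hi => ?_⟩
  · rw [← hw.1]
    congr 1
    ext i
    simp only [Finset.mem_filter, Finset.mem_univ, true_and]
    refine and_congr_right fun hi => ?_
    rw [comp_swap_apply_of_lt ha hb hi]
  · rw [comp_swap_apply_of_lt ha hb hi]
    exact hw.2 i hi

lemma laterCandidates_comp_swap {n k M j : ℕ} {w : Fin (k*n) → Fin n} {a b : Fin (k*n)}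
    (ha : a ∈ laterCandidates n k M j w) (hb : b ∈ laterCandidates n k M j w) :
    laterCandidates n k M j (w ∘ Equiv.swap a b) = laterCandidates n k M j w := by
  rw [mem_laterCandidates] at ha hb
  ext i
  simp only [mem_laterCandidates, Function.comp_apply, Equiv.swap_apply_def]
  split_ifs with h1 h2
  · subst h1; tauto
  · subst h2; tauto
  · rfl

lemma firstMax_add_one_of_eventA {n k M j l : ℕ} {w : Fin (k*n) → Fin n}
    (hl : 1 ≤ l) (hw : eventA n k M j l w) : firstMax n k M w + 1 = j := by
  obtain ⟨i, hi⟩ : (Finset.univ.filter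
      (fun i : Fin (k*n) => (i : ℕ) < M ∧ (w i : ℕ) + 1 = j)).Nonempty := by
    rw [← Finset.card_pos, hw.1]
    exact hl
  simp only [Finset.mem_filter, Finset.mem_univ, true_and] at hi
  have h1 : firstMax n k M w ≤ j - 1 := by
    refine Finset.sup_le fun t ht => ?_
    have := hw.2 t (by simpa using ht)
    omega
  have h2 : (w i : ℕ) ≤ firstMax n k M w :=
    Finset.le_sup (f := fun t => (w t : ℕ)) (by simpa using hi.1)
  omega

lemma succeedsS_iff_of_eventA {n k M j l : ℕ} {w : Fin (k*n) → Fin n} {s : Fin (k*n)}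
    (hl : 1 ≤ l) (hw : eventA n k M j l w)
    (hs : IsLeast (laterCandidates n k M j w : Set (Fin (k*n))) s) :
    succeedsS n k M w ↔ (w s : ℕ) + 1 = n := by
  have hm := firstMax_add_one_of_eventA hl hw
  have hle (i : Fin (k*n)) : firstMax n k M w ≤ (w i : ℕ) ↔ j ≤ (w i : ℕ) + 1 := by omega
  simp only [succeedsS, hle]
  have hs1 := mem_laterCandidates.1 (Finset.mem_coe.1 hs.1)
  constructor
  · rintro ⟨i, hi1, hi2, hi3, hi4⟩
    have : i = s := le_antisymm (hi3 s hs1.1 hs1.2)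
      (hs.2 (Finset.mem_coe.2 (mem_laterCandidates.2 ⟨hi1, hi2⟩)))
    rwa [← this]
  · exact fun h => ⟨s, hs1.1, hs1.2,
      fun i h1 h2 => hs.2 (Finset.mem_coe.2 (mem_laterCandidates.2 ⟨h1, h2⟩)), h⟩

lemma card_filter_rank_ge {n k j : ℕ} {w : Fin (k*n) → Fin n} (hw : w ∈ multisetPerms n k)
    (hj1 : 1 ≤ j) (hj2 : j ≤ n) :
    (Finset.univ.filter (fun i : Fin (k*n) => j ≤ (w i : ℕ) + 1)).card = k * (n - j + 1) := by
  simp only [multisetPerms, Finset.mem_filter, Finset.mem_univ, true_and] at hw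
  have hV : (Finset.Ici (⟨j - 1, by omega⟩ : Fin n)).card = n - j + 1 := by
    rw [Fin.card_Ici]
    simp only
    omega
  rw [Finset.card_eq_sum_card_fiberwise (f := w) (t := Finset.Ici (⟨j - 1, by omega⟩ : Fin n)),
    Finset.sum_congr rfl (g := fun _ => k), Finset.sum_const, hV, smul_eq_mul, mul_comm]
  · intro v hv
    refine Eq.trans ?_ (hw v)
    rw [Finset.filter_filter]
    congr 1
    ext i
    simp only [Finset.mem_filter, Finset.mem_univ, true_and, and_iff_right_iff_imp]
    rintro rfl
    rw [Finset.mem_Ici, Fin.le_def] at hv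
    simp only at hv
    omega
  · intro i hi
    simp only [Finset.coe_filter, Finset.mem_univ, true_and, Set.mem_ofPred_eq] at hi
    rw [Finset.mem_coe, Finset.mem_Ici, Fin.le_def]
    simp only
    omega

lemma card_laterCandidates_add {n k M j l : ℕ} {w : Fin (k*n) → Fin n}
    (hw : w ∈ multisetPerms n k) (hA : eventA n k M j l w) (hj1 : 1 ≤ j) (hj2 : j ≤ n) :
    (laterCandidates n k M j w).card + l = k * (n - j + 1) := by
  rw [← card_filter_rank_ge hw hj1 hj2, ← hA.1, laterCandidates, ← Finset.card_union_of_disjoint]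
  · congr 1
    ext i
    have := hA.2 i
    simp only [Finset.mem_union, Finset.mem_filter, Finset.mem_univ, true_and]
    omega
  · rw [Finset.disjoint_left]
    intro i hi
    simp only [Finset.mem_filter, Finset.mem_univ, true_and] at hi ⊢
    omega

lemma card_laterCandidates_filter_top {n k M j l : ℕ} {w : Fin (k*n) → Fin n}
    (hw : w ∈ multisetPerms n k) (hA : eventA n k M j l w) (hj : j < n) :
    ((laterCandidates n k M j w).filter (fun t => (w t : ℕ) + 1 = n)).card = k := by
  simp only [multisetPerms, Finset.mem_filter, Finset.mem_univ, true_and] at hw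
  refine Eq.trans ?_ (hw ⟨n - 1, by omega⟩)
  congr 1
  ext i
  have := hA.2 i
  simp only [Finset.mem_filter, mem_laterCandidates, Finset.mem_univ, true_and, Fin.ext_iff]
  omega

lemma card_mul_card_succeedsS_and_eventA {n k M j l N : ℕ} (hj : j < n) (hl : 1 ≤ l)
    (hN : 0 < N)
    (hcard : ∀ w ∈ multisetPerms n k, eventA n k M j l w →
      (laterCandidates n k M j w).card = N) :
    N * ((multisetPerms n k).filter (fun w => succeedsS n k M w ∧ eventA n k M j l w)).card =
      k * ((multisetPerms n k).filter (eventA n k M j l)).card := by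
  rcases isEmpty_or_nonempty (Fin (k*n)) with hE | hE
  · have hno (w : Fin (k*n) → Fin n) : ¬ eventA n k M j l w := by
      intro h
      have := h.1
      simp only [Finset.univ_eq_empty, Finset.filter_empty, Finset.card_empty] at this
      omega
    simp [hno]
  have hex (w : Fin (k*n) → Fin n) : ∃ s, w ∈ multisetPerms n k → eventA n k M j l w →
      IsLeast (laterCandidates n k M j w : Set (Fin (k*n))) s := by
    by_cases h : w ∈ multisetPerms n k ∧ eventA n k M j l w
    · have hne : (laterCandidates n k M j w).Nonempty := by
        rw [← Finset.card_pos, hcard w h.1 h.2]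
        exact hN
      exact ⟨_, fun _ _ => Finset.isLeast_min' _ hne⟩
    · exact ⟨Classical.arbitrary _, fun h1 h2 => absurd ⟨h1, h2⟩ h⟩
  choose f hf using hex
  have hswap (w : Fin (k*n) → Fin n) (t : Fin (k*n)) (hw : w ∈ multisetPerms n k)
      (hA : eventA n k M j l w) (ht : t ∈ laterCandidates n k M j w) :
      w ∘ Equiv.swap (f w) t ∈ multisetPerms n k ∧
      eventA n k M j l (w ∘ Equiv.swap (f w) t) ∧
      t ∈ laterCandidates n k M j (w ∘ Equiv.swap (f w) t) ∧
      f (w ∘ Equiv.swap (f w) t) = f w := by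
    have hs := (hf w hw hA).1
    have h1 := comp_perm_mem_multisetPerms hw (Equiv.swap (f w) t)
    have h2 := eventA_comp_swap hs ht hA
    have h3 := laterCandidates_comp_swap hs ht
    refine ⟨h1, h2, h3 ▸ ht, ?_⟩
    have h4 := hf _ h1 h2
    rw [h3] at h4
    exact h4.unique (hf w hw hA)
  have hL : (((multisetPerms n k).filter
      (fun w => succeedsS n k M w ∧ eventA n k M j l w)).sigma
        (fun w => laterCandidates n k M j w)).card =
      N * ((multisetPerms n k).filter
        (fun w => succeedsS n k M w ∧ eventA n k M j l w)).card := by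
    rw [Finset.card_sigma, Finset.sum_const_nat (m := N), mul_comm]
    intro w hw
    rw [Finset.mem_filter] at hw
    exact hcard w hw.1 hw.2.2
  have hR : (((multisetPerms n k).filter (eventA n k M j l)).sigma
        (fun w => (laterCandidates n k M j w).filter (fun t => (w t : ℕ) + 1 = n))).card =
      k * ((multisetPerms n k).filter (eventA n k M j l)).card := by
    rw [Finset.card_sigma, Finset.sum_const_nat (m := k), mul_comm]
    intro w hw
    rw [Finset.mem_filter] at hw
    exact card_laterCandidates_filter_top hw.1 hw.2 hj
  rw [← hL, ← hR]
  refine Finset.card_nbij' (fun p => ⟨p.1 ∘ Equiv.swap (f p.1) p.2, p.2⟩)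
    (fun p => ⟨p.1 ∘ Equiv.swap (f p.1) p.2, p.2⟩) ?_ ?_ ?_ ?_
  · rintro ⟨w, t⟩ hp
    simp only [Finset.coe_sigma, Set.mem_sigma_iff, Finset.mem_coe, Finset.mem_filter] at hp ⊢
    obtain ⟨⟨hw, hS, hA⟩, ht⟩ := hp
    obtain ⟨h1, h2, h3, -⟩ := hswap w t hw hA ht
    refine ⟨⟨h1, h2⟩, h3, ?_⟩
    rw [succeedsS_iff_of_eventA hl hA (hf w hw hA)] at hS
    simpa using hS
  · rintro ⟨w, t⟩ hp
    simp only [Finset.coe_sigma, Set.mem_sigma_iff, Finset.mem_coe, Finset.mem_filter] at hp ⊢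
    obtain ⟨⟨hw, hA⟩, ht, hS⟩ := hp
    obtain ⟨h1, h2, h3, h4⟩ := hswap w t hw hA ht
    refine ⟨⟨h1, ?_, h2⟩, h3⟩
    rw [succeedsS_iff_of_eventA hl h2 (hf _ h1 h2), h4]
    simpa using hS
  · rintro ⟨w, t⟩ hp
    simp only [Finset.coe_sigma, Set.mem_sigma_iff, Finset.mem_coe, Finset.mem_filter] at hp
    have h4 := (hswap w t hp.1.1 hp.1.2.2 hp.2).2.2.2
    simp only [h4, Sigma.mk.injEq, heq_eq_eq, and_true]
    ext i
    simp
  · rintro ⟨w, t⟩ hp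
    simp only [Finset.coe_sigma, Set.mem_sigma_iff, Finset.mem_coe, Finset.mem_filter] at hp
    have h4 := (hswap w t hp.1.1 hp.1.2 hp.2.1).2.2.2
    simp only [h4, Sigma.mk.injEq, heq_eq_eq, and_true]
    ext i
    simp

/-- Equation (2.2): the conditional success probability of `S(n,k;M)` given
`A^{(n)}_{M,j,l}`, for `j ≤ n-1`. -/
theorem secretary_multirank_condprob (n k M j l : ℕ) (hk : 2 ≤ k) (hn : 2 ≤ n)
    (hM1 : 1 ≤ M) (hM2 : M ≤ k*n - 1) (hj1 : 1 ≤ j) (hj2 : j ≤ n - 1)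
    (hl1 : 1 ≤ l) (hl2 : l ≤ k)
    (hpos : 0 < ((multisetPerms n k).filter (eventA n k M j l)).card) :
    (((multisetPerms n k).filter
          (fun w => succeedsS n k M w ∧ eventA n k M j l w)).card : ℝ)
        / (((multisetPerms n k).filter (eventA n k M j l)).card : ℝ)
      = (k : ℝ) / (((k*(n-j+1) : ℕ) : ℝ) - (l : ℝ)) := by
  have hkN : k * 2 ≤ k * (n - j + 1) := Nat.mul_le_mul_left k (by omega)
  have hmain := card_mul_card_succeedsS_and_eventA (n := n) (k := k) (M := M) (j := j) (l := l)
    (N := k * (n - j + 1) - l) (by omega) hl1 (by omega) (fun w hw hA => by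
      have := card_laterCandidates_add hw hA hj1 (by omega)
      omega)
  have hN : (0 : ℝ) < ((k * (n - j + 1) - l : ℕ) : ℝ) := by
    exact_mod_cast (by omega : 0 < k * (n - j + 1) - l)
  rw [← Nat.cast_sub (by omega), div_eq_div_iff (by exact_mod_cast hpos.ne') hN.ne', mul_comm]
  exact_mod_cast hmain
end
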